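/- If u and v are words of the same length n with π'_u = π'_v, then π_u = π_v. -/

import Mathlib

/- A word over alphabet `α` is modelled as `w : ℕ → α`, indexed `w 1, …, w n`. -/

/-- `IsBorder w i b`: `b` is the length of a border (possibly non-proper) of the
prefix `w[1..i]`, i.e. `b ≤ i` and `w[1..b] = w[i-b+1..i]`. -/
def IsBorder {α : Type*} (w : ℕ → α) (i b : ℕ) : Prop :=
  b ≤ i ∧ ∀ t, 1 ≤ t → t ≤ b → w t = w (i - b + t)

/-- The failure function (border array) `π_w[i]`: the length of the longest proper
border of `w[1..i]`. -/
noncomputable def piF {α : Type*} (w : ℕ → α) (i : ℕ) : ℕ :=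
  sSup {b | b < i ∧ IsBorder w i b}

/- The strong failure function `π'_w[i]` of a word of length `n`, valued in `ℤ`:
`π'_w[n] = π_w[n]`, and for `i < n` the length of the longest proper border `b` of
`w[1..i]` with `w[b+1] ≠ w[i+1]`, or `-1` if no such border exists. -/
open Classical in
noncomputable def piF' {α : Type*} (w : ℕ → α) (n i : ℕ) : ℤ :=
  if i = n then (piF w i : ℤ)
  else if ({b | b < i ∧ IsBorder w i b ∧ w (b + 1) ≠ w (i + 1)} : Set ℕ).Nonempty
    then ((sSup {b | b < i ∧ IsBorder w i b ∧ w (b + 1) ≠ w (i + 1)} : ℕ) : ℤ)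
    else -1

theorem isBorder_succ_succ_iff {α : Type*} (w : ℕ → α) (i b : ℕ) :
    IsBorder w (i + 1) (b + 1) ↔ IsBorder w i b ∧ w (b + 1) = w (i + 1) := by
  constructor
  · rintro ⟨hb, h⟩
    refine ⟨⟨by omega, fun t ht htb => ?_⟩, ?_⟩
    · rw [h t ht (by omega)]
      congr 1
      omega
    · rw [h (b + 1) (by omega) le_rfl]
      congr 1
      omega
  · rintro ⟨⟨hb, h⟩, he⟩
    refine ⟨by omega, fun t ht htb => ?_⟩
    obtain rfl | hlt := eq_or_lt_of_le htb
    · rw [he]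
      congr 1
      omega
    · rw [h t ht (by omega)]
      congr 1
      omega

theorem bddAbove_of_forall_lt {p : ℕ → Prop} (i : ℕ) : BddAbove {b | b < i ∧ p b} :=
  ⟨i, fun _ hb => hb.1.le⟩

theorem piF_mem {α : Type*} (w : ℕ → α) {i : ℕ} (hi : 1 ≤ i) :
    piF w i < i ∧ IsBorder w i (piF w i) :=
  Nat.sSup_mem (s := {b | b < i ∧ IsBorder w i b})
    ⟨0, hi, Nat.zero_le _, fun _ h₁ h₂ => by omega⟩ (bddAbove_of_forall_lt i)

theorem le_piF {α : Type*} {w : ℕ → α} {i b : ℕ} (hb : b < i) (h : IsBorder w i b) :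
    b ≤ piF w i :=
  le_csSup (bddAbove_of_forall_lt i) ⟨hb, h⟩

theorem piF'_le_piF {α : Type*} (w : ℕ → α) (n i : ℕ) : piF' w n i ≤ piF w i := by
  unfold piF'
  split_ifs with h₁ h₂
  · exact le_rfl
  · obtain ⟨hlt, hb, -⟩ := Nat.sSup_mem h₂ (bddAbove_of_forall_lt i)
    exact_mod_cast le_piF hlt hb
  · omega

theorem le_piF' {α : Type*} {w : ℕ → α} {n i b : ℕ} (hin : i ≠ n) (hb : b < i)
    (h : IsBorder w i b) (hne : w (b + 1) ≠ w (i + 1)) : (b : ℤ) ≤ piF' w n i := by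
  have hmem : b ∈ {b | b < i ∧ IsBorder w i b ∧ w (b + 1) ≠ w (i + 1)} := ⟨hb, h, hne⟩
  rw [piF', if_neg hin, if_pos ⟨b, hmem⟩]
  exact_mod_cast le_csSup (bddAbove_of_forall_lt i) hmem

theorem piF_succ_le {α : Type*} (w : ℕ → α) (i : ℕ) :
    piF w (i + 1) ≤ piF w i + 1 := by
  obtain ⟨hlt, hb⟩ := piF_mem w i.succ_pos
  cases hk : piF w (i + 1) with
  | zero => omega
  | succ k =>
    rw [Nat.succ_eq_add_one, hk] at hlt hb
    have := le_piF (by omega) ((isBorder_succ_succ_iff w i k).1 hb).1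
    omega

/-- The failure function is determined from right to left by the strong failure function. -/
theorem piF_eq_max {α : Type*} (w : ℕ → α) {n i : ℕ} (hi : 1 ≤ i) (hin : i ≠ n) :
    (piF w i : ℤ) = max (piF' w n i) (piF w (i + 1) - 1) := by
  obtain ⟨hlt, hb⟩ := piF_mem w hi
  have hstep := piF_succ_le w i
  refine le_antisymm (le_max_iff.2 ?_) (max_le (piF'_le_piF w n i) (by omega))
  by_cases he : w (piF w i + 1) = w (i + 1)
  · have := le_piF (by omega) ((isBorder_succ_succ_iff w i _).2 ⟨hb, he⟩)
    right
    omega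
  · exact Or.inl (le_piF' hin hlt hb he)

/-- If two words `u, v` of the same length `n` satisfy `π'_u = π'_v`, then `π_u = π_v`. -/
theorem pi_eq_of_pi'_eq {α β : Type*} (u : ℕ → α) (v : ℕ → β) (n : ℕ)
    (h : ∀ i, 1 ≤ i → i ≤ n → piF' u n i = piF' v n i) :
    ∀ i, 1 ≤ i → i ≤ n → piF u i = piF v i := by
  intro i hi hin
  induction hin using Nat.decreasingInduction with
  | self => simpa [piF'] using h n hi le_rfl
  | of_succ k hk ih =>
    have hu := piF_eq_max u hi hk.ne
    rw [h k hi hk.le, ih (by omega), ← piF_eq_max v hi hk.ne] at hu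
    exact_mod_cast hu
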